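/- Let G be a group and a1, a2, a3, a4, a5 ∈ G elements such that a2 and a4 commute and the braid relation a3·a4·a3 = a4·a3·a4 holds. Then the identity a1·a2·a3·a4·a5 = (a1·a4)·(a2·a5)·(a5⁻¹·a3·a4·a3⁻¹·a5) holds in G. (In the genus-two mapping class group Γ₂ this deforms the monodromy word a1a2a3a4a5 into two disjoint spherical 2-nodal singular fibers, given by a1a4 and a2a5, plus one Lefschetz nodal fiber.) -/

import Mathlib

/-- In any group `G`, if `a₂` commutes with `a₄` and the braid relation
`a₃a₄a₃ = a₄a₃a₄` holds, then
`a₁a₂a₃a₄a₅ = (a₁a₄)(a₂a₅)(a₅⁻¹a₃a₄a₃⁻¹a₅)`.  In the genus-two mapping class group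
`Γ₂` this deforms the monodromy word `a₁a₂a₃a₄a₅` into two disjoint spherical
2-nodal singular fibers, given by `a₁a₄` and `a₂a₅`, plus one Lefschetz nodal fiber. -/
theorem two_nodal_deformation_V
    {G : Type*} [Group G] (a1 a2 a3 a4 a5 : G)
    (h24 : a2 * a4 = a4 * a2) (hbraid : a3 * a4 * a3 = a4 * a3 * a4) :
    a1 * a2 * a3 * a4 * a5 =
      (a1 * a4) * (a2 * a5) * (a5⁻¹ * a3 * a4 * a3⁻¹ * a5) := by
  symm
  calc
    (a1 * a4) * (a2 * a5) * (a5⁻¹ * a3 * a4 * a3⁻¹ * a5)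
        = a1 * (a4 * a2) * a3 * a4 * a3⁻¹ * a5 := by group
    _ = a1 * (a2 * a4) * a3 * a4 * a3⁻¹ * a5 := by rw [h24]
    _ = a1 * a2 * (a4 * a3 * a4) * a3⁻¹ * a5 := by group
    _ = a1 * a2 * (a3 * a4 * a3) * a3⁻¹ * a5 := by rw [hbraid]
    _ = a1 * a2 * a3 * a4 * a5 := by group
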